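/- arXiv:2205.13207 — 4 statements merged into one kernel-verified Lean document; each statement's English description precedes it below -/
import Mathlib

section
/- Let Ω be a locally compact non-compact metrisable space, and let {μₙ} and μ be finite signed Radon measures on Ω with sup_n ‖μₙ‖ < ∞. Denote by μₙ^∞ and μ^∞ the canonical extensions of μₙ and μ to the one-point compactification Ω_∞ = Ω ∪ {∞} (obtained by setting the extended measure of any Borel set A of Ω equal to the original measure of A ∩ Ω and giving the point ∞ zero variation mass). Then μₙ → μ vaguely on Ω and μₙ(Ω) → μ(Ω) if and only if μₙ^∞ → μ^∞ weakly on Ω_∞ (i.e. ∫ f dμₙ^∞ → ∫ f dμ^∞ for every continuous f on the compact space Ω_∞). -/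
open MeasureTheory Filter Topology
open scoped ENNReal

/-- Integral of a real-valued function against a finite signed measure, via the
Hahn–Jordan decomposition `μ = μ⁺ - μ⁻`. -/
noncomputable def sInt {Ω : Type*} [MeasurableSpace Ω] (μ : SignedMeasure Ω) (f : Ω → ℝ) : ℝ :=
  (∫ x, f x ∂μ.toJordanDecomposition.posPart) - ∫ x, f x ∂μ.toJordanDecomposition.negPart

/-- Vague convergence of signed measures: convergence of integrals against all
continuous compactly supported test functions. -/
def VagueTendsto {Ω : Type*} [TopologicalSpace Ω] [MeasurableSpace Ω]
    (μs : ℕ → SignedMeasure Ω) (μ : SignedMeasure Ω) : Prop :=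
  ∀ f : Ω → ℝ, Continuous f → HasCompactSupport f →
    Tendsto (fun n => sInt (μs n) f) atTop (𝓝 (sInt μ f))

/-- Weak convergence of signed measures: convergence of integrals against all
bounded continuous test functions. -/
def WeakTendsto {Ω : Type*} [TopologicalSpace Ω] [MeasurableSpace Ω]
    (μs : ℕ → SignedMeasure Ω) (μ : SignedMeasure Ω) : Prop :=
  ∀ f : Ω → ℝ, Continuous f → (∃ C : ℝ, ∀ x, |f x| ≤ C) →
    Tendsto (fun n => sInt (μs n) f) atTop (𝓝 (sInt μ f))

/-- A bounded measurable function is integrable for a finite measure. -/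
theorem integrable_of_abs_le {X : Type*} [MeasurableSpace X] (ν : Measure X) [IsFiniteMeasure ν]
    {f : X → ℝ} (hf : Measurable f) {C : ℝ} (hC : ∀ x, |f x| ≤ C) : Integrable f ν :=
  Integrable.of_bound hf.aestronglyMeasurable C (ae_of_all _ hC)

/-- The signed integral can be computed from any decomposition as a difference of finite measures. -/
theorem sInt_eq_of_eq_sub {X : Type*} [MeasurableSpace X] {s : SignedMeasure X} {ρ σ : Measure X}
    [IsFiniteMeasure ρ] [IsFiniteMeasure σ]
    (hs : s = ρ.toSignedMeasure - σ.toSignedMeasure)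
    {f : X → ℝ} (hf : Measurable f) {C : ℝ} (hC : ∀ x, |f x| ≤ C) :
    sInt s f = (∫ x, f x ∂ρ) - ∫ x, f x ∂σ := by
  have hj : s = s.toJordanDecomposition.posPart.toSignedMeasure
      - s.toJordanDecomposition.negPart.toSignedMeasure :=
    (SignedMeasure.toSignedMeasure_toJordanDecomposition s).symm
  have hm : s.toJordanDecomposition.posPart + σ = ρ + s.toJordanDecomposition.negPart := by
    rw [← Measure.toSignedMeasure_eq_toSignedMeasure_iff, Measure.toSignedMeasure_add, Measure.toSignedMeasure_add, ← sub_eq_sub_iff_add_eq_add,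
      ← hj, hs]
  have hint := congrArg (fun ν => ∫ x, f x ∂ν) hm
  rw [integral_add_measure (integrable_of_abs_le _ hf hC) (integrable_of_abs_le _ hf hC),
    integral_add_measure (integrable_of_abs_le _ hf hC) (integrable_of_abs_le _ hf hC)] at hint
  unfold sInt
  linarith

theorem sInt_map {X Y : Type*} [MeasurableSpace X] [MeasurableSpace Y] (s : SignedMeasure X)
    {i : X → Y} (hi : Measurable i) {f : Y → ℝ} (hf : Measurable f) {C : ℝ}
    (hC : ∀ y, |f y| ≤ C) : sInt (s.map i) f = sInt s (fun x => f (i x)) := by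
  have hj := SignedMeasure.toSignedMeasure_toJordanDecomposition s
  have hs : s.map i = (s.toJordanDecomposition.posPart.map i).toSignedMeasure
      - (s.toJordanDecomposition.negPart.map i).toSignedMeasure := by
    ext A hA
    rw [VectorMeasure.map_apply _ hi hA]
    conv_lhs => rw [← hj]
    simp [JordanDecomposition.toSignedMeasure, hA, hi hA, measureReal_def, Measure.map_apply hi hA]
  rw [sInt_eq_of_eq_sub hs hf hC, integral_map hi.aemeasurable hf.aestronglyMeasurable,
    integral_map hi.aemeasurable hf.aestronglyMeasurable, sInt]

theorem sInt_add {X : Type*} [MeasurableSpace X] (s : SignedMeasure X) {f g : X → ℝ}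
    (hf : Measurable f) {C : ℝ} (hC : ∀ x, |f x| ≤ C)
    (hg : Measurable g) {D : ℝ} (hD : ∀ x, |g x| ≤ D) :
    sInt s (fun x => f x + g x) = sInt s f + sInt s g := by
  unfold sInt
  rw [integral_add (integrable_of_abs_le _ hf hC) (integrable_of_abs_le _ hg hD),
    integral_add (integrable_of_abs_le _ hf hC) (integrable_of_abs_le _ hg hD)]
  ring

theorem sInt_const {X : Type*} [MeasurableSpace X] (s : SignedMeasure X) (c : ℝ) :
    sInt s (fun _ => c) = s Set.univ * c := by
  have hj := SignedMeasure.toSignedMeasure_toJordanDecomposition s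
  conv_rhs => rw [← hj]
  simp [sInt, JordanDecomposition.toSignedMeasure, sub_mul]

theorem abs_sInt_le {X : Type*} [MeasurableSpace X] (s : SignedMeasure X) {f : X → ℝ} {C : ℝ}
    (hC : ∀ x, |f x| ≤ C) : |sInt s f| ≤ C * s.totalVariation.real Set.univ := by
  have h1 := norm_integral_le_of_norm_le_const (μ := s.toJordanDecomposition.posPart)
    (ae_of_all _ fun x => (Real.norm_eq_abs _).trans_le (hC x))
  have h2 := norm_integral_le_of_norm_le_const (μ := s.toJordanDecomposition.negPart)
    (ae_of_all _ fun x => (Real.norm_eq_abs _).trans_le (hC x))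
  rw [SignedMeasure.totalVariation, measureReal_add_apply, mul_add]
  exact (abs_sub _ _).trans (add_le_add h1 h2)

/-- Convergence of signed integrals passes to uniform limits of test functions when the total
variations are uniformly bounded. -/
theorem tendsto_sInt_of_uniform_approx {X : Type*} [MeasurableSpace X] {μs : ℕ → SignedMeasure X}
    {μ : SignedMeasure X} {M : ℝ} (hMs : ∀ n, (μs n).totalVariation.real Set.univ ≤ M)
    (hM : μ.totalVariation.real Set.univ ≤ M) {g : X → ℝ}
    (hg : ∀ ε > 0, ∃ h r : X → ℝ, Measurable h ∧ (∃ C, ∀ x, |h x| ≤ C) ∧ Measurable r ∧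
      (∀ x, |r x| ≤ ε) ∧ (∀ x, g x = h x + r x) ∧
      Tendsto (fun n => sInt (μs n) h) atTop (𝓝 (sInt μ h))) :
    Tendsto (fun n => sInt (μs n) g) atTop (𝓝 (sInt μ g)) := by
  have hM0 : 0 ≤ M := measureReal_nonneg.trans hM
  rw [Metric.tendsto_atTop]
  intro ε hε
  obtain ⟨h, r, hh, ⟨C, hC⟩, hr, hrε, hghr, hlim⟩ := hg (ε / (3 * (M + 1))) (by positivity)
  obtain ⟨N, hN⟩ := Metric.tendsto_atTop.1 hlim (ε / 3) (by positivity)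
  refine ⟨N, fun n hn => ?_⟩
  have hsplit (s : SignedMeasure X) : sInt s g = sInt s h + sInt s r := by
    rw [← sInt_add s hh hC hr hrε, funext hghr]
  have hsmall (s : SignedMeasure X) (hs : s.totalVariation.real Set.univ ≤ M) :
      |sInt s r| < ε / 3 := by
    calc |sInt s r| ≤ ε / (3 * (M + 1)) * s.totalVariation.real Set.univ := abs_sInt_le s hrε
      _ ≤ ε / (3 * (M + 1)) * M := by gcongr
      _ < ε / (3 * (M + 1)) * (M + 1) := by gcongr; linarith
      _ = ε / 3 := by field_simp
  have h1 := abs_lt.1 (hsmall _ (hMs n))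
  have h2 := abs_lt.1 (hsmall _ hM)
  have h3 := hN n hn
  rw [Real.dist_eq] at h3 ⊢
  rw [hsplit, hsplit]
  have h4 := abs_lt.1 h3
  rw [abs_lt]
  constructor <;> linarith [h1.1, h1.2, h2.1, h2.2, h4.1, h4.2]

/-- A continuous function vanishing at infinity is uniformly approximated by its soft thresholdings,
which are compactly supported. -/
theorem exists_compactSupport_add_small {X : Type*} [TopologicalSpace X] {g : X → ℝ}
    (hg : Continuous g) (hg0 : Tendsto g (cocompact X) (𝓝 0)) {ε : ℝ} (hε : 0 < ε) :
    ∃ h r : X → ℝ, Continuous h ∧ HasCompactSupport h ∧ Continuous r ∧ (∀ x, |r x| ≤ ε) ∧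
      ∀ x, g x = h x + r x := by
  have hr : Continuous fun x => max (-ε) (min (g x) ε) := by fun_prop
  refine ⟨fun x => g x - max (-ε) (min (g x) ε), fun x => max (-ε) (min (g x) ε),
    hg.sub hr, ?_, hr, fun x => ?_, fun x => by ring⟩
  · obtain ⟨K, hK, hKε⟩ := mem_cocompact.1 (hg0 (Metric.ball_mem_nhds 0 hε))
    have hclosed : IsClosed {x | ε ≤ |g x|} := isClosed_le continuous_const hg.abs
    have hcompact : IsCompact {x | ε ≤ |g x|} := by
      refine hK.of_isClosed_subset hclosed fun x hx => ?_
      by_contra hxK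
      have := hKε hxK
      simp only [Set.mem_preimage, Metric.mem_ball, dist_zero_right, Real.norm_eq_abs] at this
      exact absurd hx (not_le.2 this)
    refine hcompact.of_isClosed_subset (isClosed_tsupport _) (closure_minimal (fun x hx => ?_) hclosed)
    by_contra hlt
    have hlt' : |g x| < ε := not_le.1 hlt
    rw [abs_lt] at hlt'
    exact hx (by simp [min_eq_left hlt'.2.le, max_eq_right hlt'.1.le])
  · exact abs_le.2 ⟨le_max_left _ _, max_le (by linarith) (min_le_right _ _)⟩

/-- A compactly supported continuous function extends continuously by zero to the one-point
compactification. -/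
theorem continuous_onePoint_extend_zero {X : Type*} [TopologicalSpace X] [T2Space X] {f : X → ℝ}
    (hf : Continuous f) (hc : HasCompactSupport f) :
    Continuous (fun x : OnePoint X => x.elim 0 f) := by
  rw [OnePoint.continuous_iff]
  refine ⟨?_, hf⟩
  rw [coclosedCompact_eq_cocompact]
  exact hc.is_zero_at_infty

theorem stmt3 {Ω : Type*} [TopologicalSpace Ω] [TopologicalSpace.MetrizableSpace Ω] [LocallyCompactSpace Ω]
    [NoncompactSpace Ω] [MeasurableSpace Ω] [BorelSpace Ω]
    [MeasurableSpace (OnePoint Ω)] [BorelSpace (OnePoint Ω)]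
    (μs : ℕ → SignedMeasure Ω) (μ : SignedMeasure Ω)
    (hRadonn : ∀ n, ((μs n).totalVariation).InnerRegular)
    (hRadon : (μ.totalVariation).InnerRegular)
    (hbdd : (⨆ n, (μs n).totalVariation Set.univ) < ⊤) :
    (VagueTendsto μs μ ∧ Tendsto (fun n => μs n Set.univ) atTop (𝓝 (μ Set.univ)))
      ↔ (∀ f : OnePoint Ω → ℝ, Continuous f →
          Tendsto (fun n => sInt ((μs n).map (fun x => (x : OnePoint Ω))) f) atTop
            (𝓝 (sInt (μ.map (fun x => (x : OnePoint Ω))) f))) := by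
  have hcoe : Continuous (fun x : Ω => (x : OnePoint Ω)) := OnePoint.continuous_coe
  have hbound (f : OnePoint Ω → ℝ) (hf : Continuous f) : ∃ C, ∀ x, |f x| ≤ C := by
    obtain ⟨C, hC⟩ := isCompact_univ.exists_bound_of_continuousOn hf.continuousOn
    exact ⟨C, fun x => hC x (Set.mem_univ x)⟩
  have hmap (s : SignedMeasure Ω) (f : OnePoint Ω → ℝ) (hf : Continuous f) :
      sInt (s.map (fun x => (x : OnePoint Ω))) f = sInt s (fun x : Ω => f x) := by
    obtain ⟨C, hC⟩ := hbound f hf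
    exact sInt_map s hcoe.measurable hf.measurable hC
  constructor
  · rintro ⟨hvague, hmass⟩ f hf
    simp_rw [hmap _ f hf]
    have hg : Continuous fun x : Ω => f x - f OnePoint.infty := by fun_prop
    have hg0 : Tendsto (fun x : Ω => f x - f OnePoint.infty) (cocompact Ω) (𝓝 0) := by
      have := ((OnePoint.continuous_iff f).1 hf).1
      rw [coclosedCompact_eq_cocompact] at this
      simpa using this.sub_const (f OnePoint.infty)
    have hle (n : ℕ) : (μs n).totalVariation.real Set.univ
        ≤ (⨆ n, (μs n).totalVariation Set.univ).toReal :=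
      ENNReal.toReal_mono hbdd.ne (le_iSup (fun n => (μs n).totalVariation Set.univ) n)
    have hlim : Tendsto (fun n => sInt (μs n) fun x : Ω => f x - f OnePoint.infty) atTop
        (𝓝 (sInt μ fun x : Ω => f x - f OnePoint.infty)) := by
      refine tendsto_sInt_of_uniform_approx (fun n => (hle n).trans (le_max_left _ _))
        (le_max_right _ (μ.totalVariation.real Set.univ)) fun ε hε => ?_
      obtain ⟨h, r, hh, hhc, hr, hrε, hsum⟩ := exists_compactSupport_add_small hg hg0 hε
      exact ⟨h, r, hh.measurable, hhc.exists_bound_of_continuous hh, hr.measurable, hrε, hsum,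
        hvague h hh hhc⟩
    obtain ⟨C, hC⟩ := hbound _ (hf.sub continuous_const : Continuous fun x => f x - f OnePoint.infty)
    have hsplit (s : SignedMeasure Ω) : sInt s (fun x : Ω => f x)
        = sInt s (fun x : Ω => f x - f OnePoint.infty) + s Set.univ * f OnePoint.infty := by
      rw [← sInt_const, ← sInt_add s hg.measurable (fun x => hC x) measurable_const
        (fun _ => le_rfl)]
      simp
    simp_rw [hsplit]
    exact hlim.add (hmass.mul_const _)
  · intro hweak
    refine ⟨fun f hf hc => ?_, ?_⟩
    · have hF := continuous_onePoint_extend_zero hf hc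
      simpa only [hmap _ _ hF, OnePoint.elim_some] using hweak _ hF
    · have hone : Continuous fun _ : OnePoint Ω => (1 : ℝ) := continuous_const
      simpa only [hmap _ _ hone, sInt_const, mul_one] using hweak _ hone
end

section
/- Let Ω be a locally compact metrisable space and let {μₙ} and μ be finite signed Radon measures on Ω with Hahn–Jordan decompositions μₙ = μₙ⁺ − μₙ⁻ and μ = μ⁺ − μ⁻. If μₙ → μ vaguely and for every compact set K ⊆ Ω one has limsup_{n→∞} |μₙ|(K) ≤ |μ|(K), then μₙ⁺ → μ⁺ vaguely and μₙ⁻ → μ⁻ vaguely (and consequently |μₙ| → |μ| vaguely). -/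
open MeasureTheory Filter Topology
open scoped ENNReal

/-- Upper bound for integrals of nonnegative test functions, from upper semicontinuity on compacts. -/
lemma eventually_integral_lt_of_limsup_measure_isCompact_le {Ω : Type*} [TopologicalSpace Ω]
    [MeasurableSpace Ω] [BorelSpace Ω] {νs : ℕ → Measure Ω} {ν : Measure Ω}
    [∀ n, IsFiniteMeasure (νs n)] [IsFiniteMeasure ν]
    (hcompact : ∀ K : Set Ω, IsCompact K → limsup (fun n => νs n K) atTop ≤ ν K)
    {f : Ω → ℝ} (hf : Continuous f) (hfc : HasCompactSupport f) (hf0 : 0 ≤ f)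
    {a : ℝ} (ha : ∫ x, f x ∂ν < a) : ∀ᶠ n in atTop, ∫ x, f x ∂(νs n) < a := by
  have hint (m : Measure Ω) [IsFiniteMeasure m] : Integrable f m :=
    hf.integrable_of_hasCompactSupport hfc
  have hlevel (t : ℝ) (ht : 0 < t) : IsCompact {x | t ≤ f x} := by
    refine hfc.isCompact.of_isClosed_subset (isClosed_le continuous_const hf) fun x hx => ?_
    exact subset_tsupport f (ht.trans_le hx).ne'
  obtain ⟨M, hM⟩ := hf.bounded_above_of_compact_support hfc
  have hfM (x : Ω) : f x ≤ M := (le_abs_self _).trans (hM x)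
  have hevt : ∀ᶠ n in atTop, νs n (tsupport f) < ν (tsupport f) + 1 :=
    eventually_lt_of_limsup_lt ((hcompact _ hfc.isCompact).trans_lt
      (ENNReal.lt_add_right (measure_ne_top _ _) one_ne_zero))
  obtain ⟨N, hN⟩ := eventually_atTop.1 hevt
  have hlim : limsup (fun n => ∫⁻ x, ENNReal.ofReal (f x) ∂(νs (n + N))) atTop
      ≤ ∫⁻ x, ENNReal.ofReal (f x) ∂ν := by
    have hlayer (m : Measure Ω) [IsFiniteMeasure m] :=
      lintegral_eq_lintegral_meas_le m (ae_of_all _ hf0) hf.aemeasurable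
    simp_rw [hlayer]
    refine (limsup_lintegral_le
      ((Set.Iic M).indicator fun _ => ν (tsupport f) + 1) ?_ ?_ ?_).trans ?_
    · intro n
      exact Antitone.measurable fun s t hst => measure_mono fun x hx => hst.trans hx
    · intro n
      filter_upwards [ae_restrict_mem measurableSet_Ioi] with t ht
      by_cases htM : t ≤ M
      · rw [Set.indicator_of_mem (Set.mem_Iic.2 htM)]
        refine (measure_mono fun x hx => ?_).trans (hN (n + N) (Nat.le_add_left _ _)).le
        exact subset_tsupport f ((Set.mem_Ioi.1 ht).trans_le hx).ne'
      · have hempty : {x | t ≤ f x} = ∅ :=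
          Set.eq_empty_of_forall_notMem fun x hx => htM (le_trans hx (hfM x))
        simp [hempty]
    · rw [lintegral_indicator measurableSet_Iic, setLIntegral_const,
        Measure.restrict_apply measurableSet_Iic, Set.inter_comm, Set.Ioi_inter_Iic,
        Real.volume_Ioc]
      exact ENNReal.mul_ne_top (by simp) ENNReal.ofReal_ne_top
    · refine lintegral_mono_ae ?_
      filter_upwards [ae_restrict_mem measurableSet_Ioi] with t ht
      rw [limsup_nat_add (fun n => νs n {x | t ≤ f x}) N]
      exact hcompact _ (hlevel t ht)
  rw [limsup_nat_add (fun n => ∫⁻ x, ENNReal.ofReal (f x) ∂(νs n)) N] at hlim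
  have hapos : 0 < a := (integral_nonneg hf0).trans_lt ha
  have hlt : limsup (fun n => ∫⁻ x, ENNReal.ofReal (f x) ∂(νs n)) atTop < ENNReal.ofReal a := by
    refine hlim.trans_lt ?_
    rw [← ofReal_integral_eq_lintegral_ofReal (hint ν) (ae_of_all _ hf0)]
    exact (ENNReal.ofReal_lt_ofReal_iff hapos).2 ha
  filter_upwards [eventually_lt_of_limsup_lt hlt] with n hn
  rw [← ofReal_integral_eq_lintegral_ofReal (hint _) (ae_of_all _ hf0)] at hn
  exact (ENNReal.ofReal_lt_ofReal_iff hapos).1 hn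

instance isFiniteMeasure_totalVariation {Ω : Type*} [MeasurableSpace Ω] (μ : SignedMeasure Ω) :
    IsFiniteMeasure μ.totalVariation := by
  unfold SignedMeasure.totalVariation
  infer_instance

lemma sInt_mul_le_integral_totalVariation {Ω : Type*} [MeasurableSpace Ω] (μ : SignedMeasure Ω)
    {f g : Ω → ℝ} (hf0 : 0 ≤ f) (hg : ∀ x, |g x| ≤ 1)
    (hfp : Integrable f μ.toJordanDecomposition.posPart)
    (hfn : Integrable f μ.toJordanDecomposition.negPart)
    (hfgp : Integrable (fun x => f x * g x) μ.toJordanDecomposition.posPart)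
    (hfgn : Integrable (fun x => f x * g x) μ.toJordanDecomposition.negPart) :
    sInt μ (fun x => f x * g x) ≤ ∫ x, f x ∂μ.totalVariation := by
  rw [SignedMeasure.totalVariation, integral_add_measure hfp hfn, sInt]
  have hp := integral_mono hfgp hfp fun x => by
    have := mul_le_mul_of_nonneg_left (abs_le.1 (hg x)).2 (hf0 x)
    simpa using this
  have hn := integral_mono hfn.neg hfgn fun x => by
    have := mul_le_mul_of_nonneg_left (abs_le.1 (hg x)).1 (hf0 x)
    simpa using this
  simp only [Pi.neg_apply, integral_neg] at hn
  linarith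

/-- The sign of the Hahn decomposition is approximated in `L¹` by continuous functions bounded
by one. -/
lemma exists_continuous_integral_one_sub_add_integral_one_add_le {Ω : Type*} [TopologicalSpace Ω]
    [TopologicalSpace.MetrizableSpace Ω] [MeasurableSpace Ω] [BorelSpace Ω]
    (μ : SignedMeasure Ω) {ε : ℝ} (hε : 0 < ε) :
    ∃ g : Ω → ℝ, Continuous g ∧ (∀ x, |g x| ≤ 1) ∧
      (∫ x, (1 - g x) ∂μ.toJordanDecomposition.posPart)
        + ∫ x, (1 + g x) ∂μ.toJordanDecomposition.negPart ≤ ε := by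
  let _ := TopologicalSpace.metrizableSpaceMetric Ω
  obtain ⟨s, hs, hsp, hsn⟩ := μ.toJordanDecomposition.mutuallySingular
  set p := μ.toJordanDecomposition.posPart
  set q := μ.toJordanDecomposition.negPart
  classical
  let h : Ω → ℝ := s.piecewise (fun _ => -1) (fun _ => 1)
  have hhm : Measurable h := measurable_const.piecewise hs measurable_const
  have hhb (x : Ω) : |h x| ≤ 1 := by
    by_cases hx : x ∈ s <;> simp [h, hx]
  have hhi : Integrable h (p + q) :=
    Integrable.of_bound hhm.aestronglyMeasurable 1 (ae_of_all _ hhb)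
  obtain ⟨g, hg, hgi⟩ := hhi.exists_boundedContinuous_integral_sub_le hε
  let k : Ω → ℝ := fun x => max (-1) (min 1 (g x))
  have hk : Continuous k := by fun_prop
  have hkb (x : Ω) : |k x| ≤ 1 :=
    abs_le.2 ⟨le_max_left _ _, max_le (by norm_num) (min_le_left _ _)⟩
  have hki (m : Measure Ω) [IsFiniteMeasure m] : Integrable k m :=
    Integrable.of_bound hk.aestronglyMeasurable 1 (ae_of_all _ hkb)
  have hkh (x : Ω) : |h x - k x| ≤ ‖h x - g x‖ := by
    have hh : h x = max (-1) (min 1 (h x)) := by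
      rw [min_eq_right (abs_le.1 (hhb x)).2, max_eq_right (abs_le.1 (hhb x)).1]
    rw [hh, Real.norm_eq_abs]
    nth_rewrite 2 [← hh]
    refine (abs_max_sub_max_le_max _ _ _ _).trans (max_le (by simp) ?_)
    exact (abs_min_sub_min_le_max _ _ _ _).trans (max_le (by simp) le_rfl)
  refine ⟨k, hk, hkb, ?_⟩
  have hdi : Integrable (fun x => |h x - k x|) (p + q) := (hhi.sub (hki _)).abs
  have hp : ∫ x, (1 - k x) ∂p = ∫ x, |h x - k x| ∂p := by
    refine integral_congr_ae ?_
    filter_upwards [measure_eq_zero_iff_ae_notMem.1 hsp] with x hx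
    simp [h, hx, abs_of_nonneg (sub_nonneg.2 (abs_le.1 (hkb x)).2)]
  have hq : ∫ x, (1 + k x) ∂q = ∫ x, |h x - k x| ∂q := by
    refine integral_congr_ae ?_
    filter_upwards [measure_eq_zero_iff_ae_notMem.1 hsn] with x hx
    have hxs : x ∈ s := by simpa using hx
    have hle : -1 - k x ≤ 0 := by linarith [(abs_le.1 (hkb x)).1]
    simp only [h, Set.piecewise_eq_of_mem _ _ _ hxs, abs_of_nonpos hle]
    ring
  rw [hp, hq, ← integral_add_measure hdi.left_of_add_measure hdi.right_of_add_measure]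
  exact (integral_mono hdi (hhi.sub hgi).norm hkh).trans hg

/-- Lower semicontinuity of the total variation under vague convergence. -/
lemma VagueTendsto.eventually_lt_integral_totalVariation {Ω : Type*} [TopologicalSpace Ω]
    [TopologicalSpace.MetrizableSpace Ω] [MeasurableSpace Ω] [BorelSpace Ω]
    {μs : ℕ → SignedMeasure Ω} {μ : SignedMeasure Ω} (hvague : VagueTendsto μs μ)
    {f : Ω → ℝ} (hf : Continuous f) (hfc : HasCompactSupport f) (hf0 : 0 ≤ f)
    {a : ℝ} (ha : a < ∫ x, f x ∂μ.totalVariation) :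
    ∀ᶠ n in atTop, a < ∫ x, f x ∂(μs n).totalVariation := by
  obtain ⟨M, hM⟩ := hf.bounded_above_of_compact_support hfc
  have hfM (x : Ω) : f x ≤ |M| + 1 := by
    linarith [le_abs_self (f x), hM x, le_abs_self M, Real.norm_eq_abs (f x)]
  have hMpos : 0 < |M| + 1 := by positivity
  set δ := (∫ x, f x ∂μ.totalVariation) - a
  have hδ : 0 < δ := sub_pos.2 ha
  obtain ⟨g, hgc, hg1, hg⟩ := exists_continuous_integral_one_sub_add_integral_one_add_le μ
    (ε := δ / (2 * (|M| + 1))) (by positivity)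
  have hfg : Continuous fun x => f x * g x := hf.mul hgc
  have hfgc : HasCompactSupport fun x => f x * g x := hfc.mul_right
  have hfi (m : Measure Ω) [IsFiniteMeasure m] : Integrable f m :=
    hf.integrable_of_hasCompactSupport hfc
  have hfgi (m : Measure Ω) [IsFiniteMeasure m] : Integrable (fun x => f x * g x) m :=
    hfg.integrable_of_hasCompactSupport hfgc
  have hgi (m : Measure Ω) [IsFiniteMeasure m] : Integrable g m :=
    Integrable.of_bound hgc.aestronglyMeasurable 1 (ae_of_all _ hg1)
  have hlt : a < sInt μ (fun x => f x * g x) := by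
    have hp : ∫ x, (f x - f x * g x) ∂μ.toJordanDecomposition.posPart
        ≤ ∫ x, (|M| + 1) * (1 - g x) ∂μ.toJordanDecomposition.posPart := by
      refine integral_mono ((hfi _).sub (hfgi _))
        (((integrable_const 1).sub (hgi _)).const_mul _) fun x => ?_
      have := mul_le_mul_of_nonneg_right (hfM x) (sub_nonneg.2 (abs_le.1 (hg1 x)).2)
      dsimp only
      linarith
    have hn : ∫ x, (f x + f x * g x) ∂μ.toJordanDecomposition.negPart
        ≤ ∫ x, (|M| + 1) * (1 + g x) ∂μ.toJordanDecomposition.negPart := by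
      refine integral_mono ((hfi _).add (hfgi _))
        (((integrable_const 1).add (hgi _)).const_mul _) fun x => ?_
      have h0 : 0 ≤ 1 + g x := by linarith [(abs_le.1 (hg1 x)).1]
      have := mul_le_mul_of_nonneg_right (hfM x) h0
      dsimp only
      linarith
    rw [integral_sub (hfi _) (hfgi _), integral_const_mul] at hp
    rw [integral_add (hfi _) (hfgi _), integral_const_mul] at hn
    have hhalf := mul_le_mul_of_nonneg_left hg hMpos.le
    have heq : (|M| + 1) * (δ / (2 * (|M| + 1))) = δ / 2 := by field_simp
    have htv : ∫ x, f x ∂μ.totalVariation = (∫ x, f x ∂μ.toJordanDecomposition.posPart)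
        + ∫ x, f x ∂μ.toJordanDecomposition.negPart :=
      integral_add_measure (hfi _) (hfi _)
    have hδdef : δ = (∫ x, f x ∂μ.totalVariation) - a := rfl
    rw [sInt]
    linarith
  filter_upwards [(hvague _ hfg hfgc).eventually_const_lt hlt] with n hn
  exact hn.trans_le
    (sInt_mul_le_integral_totalVariation _ hf0 hg1 (hfi _) (hfi _) (hfgi _) (hfgi _))

/-- Convergence of integrals of test functions may be tested on nonnegative ones. -/
lemma tendsto_integral_of_nonneg {Ω : Type*} [TopologicalSpace Ω] [MeasurableSpace Ω]
    [OpensMeasurableSpace Ω] {νs : ℕ → Measure Ω} {ν : Measure Ω}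
    [∀ n, IsFiniteMeasure (νs n)] [IsFiniteMeasure ν]
    (h : ∀ f : Ω → ℝ, Continuous f → HasCompactSupport f → 0 ≤ f →
      Tendsto (fun n => ∫ x, f x ∂(νs n)) atTop (𝓝 (∫ x, f x ∂ν)))
    {f : Ω → ℝ} (hf : Continuous f) (hfc : HasCompactSupport f) :
    Tendsto (fun n => ∫ x, f x ∂(νs n)) atTop (𝓝 (∫ x, f x ∂ν)) := by
  have hp : Continuous fun x => max (f x) 0 := by fun_prop
  have hn : Continuous fun x => max (-f x) 0 := by fun_prop
  have hpc : HasCompactSupport fun x => max (f x) 0 :=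
    hfc.comp_left (g := fun y : ℝ => max y 0) (by simp)
  have hnc : HasCompactSupport fun x => max (-f x) 0 :=
    hfc.comp_left (g := fun y : ℝ => max (-y) 0) (by simp)
  have hsplit (m : Measure Ω) [IsFiniteMeasure m] :
      ∫ x, f x ∂m = (∫ x, max (f x) 0 ∂m) - ∫ x, max (-f x) 0 ∂m := by
    rw [← integral_sub (hp.integrable_of_hasCompactSupport hpc)
      (hn.integrable_of_hasCompactSupport hnc)]
    refine integral_congr_ae (ae_of_all _ fun x => ?_)
    simpa only [max_comm] using (max_zero_sub_max_neg_zero_eq_self (f x)).symm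
  simp_rw [hsplit]
  exact (h _ hp hpc fun x => le_max_right _ _).sub (h _ hn hnc fun x => le_max_right _ _)

theorem stmt5 {Ω : Type*} [TopologicalSpace Ω] [TopologicalSpace.MetrizableSpace Ω] [LocallyCompactSpace Ω]
    [MeasurableSpace Ω] [BorelSpace Ω]
    (μs : ℕ → SignedMeasure Ω) (μ : SignedMeasure Ω)
    (hRadonn : ∀ n, ((μs n).totalVariation).InnerRegular)
    (hRadon : (μ.totalVariation).InnerRegular)
    (hvague : VagueTendsto μs μ)
    (hcompact : ∀ K : Set Ω, IsCompact K →
      limsup (fun n => (μs n).totalVariation K) atTop ≤ μ.totalVariation K) :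
    (∀ f : Ω → ℝ, Continuous f → HasCompactSupport f →
      Tendsto (fun n => ∫ x, f x ∂(μs n).toJordanDecomposition.posPart) atTop
        (𝓝 (∫ x, f x ∂μ.toJordanDecomposition.posPart))) ∧
    (∀ f : Ω → ℝ, Continuous f → HasCompactSupport f →
      Tendsto (fun n => ∫ x, f x ∂(μs n).toJordanDecomposition.negPart) atTop
        (𝓝 (∫ x, f x ∂μ.toJordanDecomposition.negPart))) ∧
    (∀ f : Ω → ℝ, Continuous f → HasCompactSupport f →
      Tendsto (fun n => ∫ x, f x ∂(μs n).totalVariation) atTop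
        (𝓝 (∫ x, f x ∂μ.totalVariation))) := by
  have htv (f : Ω → ℝ) (hf : Continuous f) (hfc : HasCompactSupport f) :
      Tendsto (fun n => ∫ x, f x ∂(μs n).totalVariation) atTop
        (𝓝 (∫ x, f x ∂μ.totalVariation)) :=
    tendsto_integral_of_nonneg (fun g hg hgc hg0 => tendsto_order.2
      ⟨fun _ ha => hvague.eventually_lt_integral_totalVariation hg hgc hg0 ha,
        fun _ ha => eventually_integral_lt_of_limsup_measure_isCompact_le hcompact hg hgc hg0 ha⟩)
      hf hfc
  have hadd (m : SignedMeasure Ω) (f : Ω → ℝ) (hf : Continuous f) (hfc : HasCompactSupport f) :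
      ∫ x, f x ∂m.totalVariation = (∫ x, f x ∂m.toJordanDecomposition.posPart)
        + ∫ x, f x ∂m.toJordanDecomposition.negPart :=
    integral_add_measure (hf.integrable_of_hasCompactSupport hfc)
      (hf.integrable_of_hasCompactSupport hfc)
  refine ⟨fun f hf hfc => ?_, fun f hf hfc => ?_, htv⟩
  · have hpos (m : SignedMeasure Ω) : ∫ x, f x ∂m.toJordanDecomposition.posPart
        = ((∫ x, f x ∂m.totalVariation) + sInt m f) / 2 := by
      rw [hadd m f hf hfc, sInt]
      ring
    simp_rw [hpos]
    exact ((htv f hf hfc).add (hvague f hf hfc)).div_const 2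
  · have hneg (m : SignedMeasure Ω) : ∫ x, f x ∂m.toJordanDecomposition.negPart
        = ((∫ x, f x ∂m.totalVariation) - sInt m f) / 2 := by
      rw [hadd m f hf hfc, sInt]
      ring
    simp_rw [hneg]
    exact ((htv f hf hfc).sub (hvague f hf hfc)).div_const 2
end

section
/- In the proof of Proposition 2.7 the following intermediate claim is established: let Ω be a locally compact metrisable space and {μₙ}, μ finite signed Radon measures on Ω with μₙ → μ vaguely and limsup_{n→∞} ‖μₙ‖ ≤ ‖μ‖. Then the sequence {μₙ} is tight, i.e. for every ε > 0 there exists a compact set Kε ⊆ Ω with limsup_{n→∞} |μₙ|(Kε^c) ≤ ε. -/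
open MeasureTheory Filter Topology
open scoped ENNReal

theorem abs_integral_le_mul_measureReal {Ω : Type*} [MeasurableSpace Ω] (ν : Measure Ω)
    [IsFiniteMeasure ν] {g : Ω → ℝ} {C : ℝ} {S : Set Ω}
    (hC : ∀ x, |g x| ≤ C) (hS : ∀ x, x ∉ S → g x = 0) :
    |∫ x, g x ∂ν| ≤ C * ν.real S := by
  rw [← setIntegral_eq_integral_of_forall_compl_eq_zero hS, ← Real.norm_eq_abs]
  exact norm_setIntegral_le_of_norm_le_const (measure_lt_top ν S) fun x _ => hC x

theorem totalVariation_real_apply {Ω : Type*} [MeasurableSpace Ω] (μ : SignedMeasure Ω)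
    (S : Set Ω) :
    μ.totalVariation.real S = μ.toJordanDecomposition.posPart.real S
      + μ.toJordanDecomposition.negPart.real S :=
  measureReal_add_apply

theorem sInt_le_totalVariation_real {Ω : Type*} [MeasurableSpace Ω] (μ : SignedMeasure Ω)
    {f : Ω → ℝ} {L : Set Ω} (hf : ∀ x, |f x| ≤ 1) (hL : ∀ x, x ∉ L → f x = 0) :
    sInt μ f ≤ μ.totalVariation.real L := by
  have h₁ := abs_le.1 (abs_integral_le_mul_measureReal μ.toJordanDecomposition.posPart hf hL)
  have h₂ := abs_le.1 (abs_integral_le_mul_measureReal μ.toJordanDecomposition.negPart hf hL)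
  rw [totalVariation_real_apply, sInt]
  linarith

/-- The total variation norm of a Radon signed measure on a locally compact space is approximated
by integrals of compactly supported continuous functions bounded by one. -/
theorem exists_hasCompactSupport_totalVariation_sub_le_sInt {Ω : Type*} [TopologicalSpace Ω]
    [T2Space Ω] [LocallyCompactSpace Ω] [MeasurableSpace Ω] [BorelSpace Ω]
    (μ : SignedMeasure Ω) (hμ : μ.totalVariation.InnerRegular) {δ : ℝ} (hδ : 0 < δ) :
    ∃ f : Ω → ℝ, Continuous f ∧ HasCompactSupport f ∧ (∀ x, |f x| ≤ 1) ∧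
      μ.totalVariation.real Set.univ - δ ≤ sInt μ f := by
  obtain ⟨N, hN, hpN, hqN⟩ := μ.toJordanDecomposition.mutuallySingular
  have hδ' : ENNReal.ofReal (δ / 4) ≠ 0 := by simpa using hδ
  obtain ⟨K, hKN, hK, hKm⟩ := hN.compl.exists_isCompact_sdiff_lt
    (measure_ne_top μ.totalVariation _) hδ'
  obtain ⟨K', hKN', hK', hKm'⟩ := hN.exists_isCompact_sdiff_lt
    (measure_ne_top μ.totalVariation _) hδ'
  have hdisj : Disjoint K K' :=
    (disjoint_compl_left (a := N)).mono hKN hKN'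
  obtain ⟨f, hfK, hfK', hfc, hf⟩ :=
    exists_continuous_one_zero_of_isCompact hK hK'.isClosed hdisj
  obtain ⟨g, hgK', hgK, hgc, hg⟩ :=
    exists_continuous_one_zero_of_isCompact hK' hK.isClosed hdisj.symm
  have hbound : ∀ x, |f x - g x| ≤ 1 := fun x =>
    abs_le.2 ⟨by linarith [(hf x).1, (hg x).2], by linarith [(hf x).2, (hg x).1]⟩
  refine ⟨fun x => f x - g x, by fun_prop, hfc.sub hgc, hbound, ?_⟩
  set p := μ.toJordanDecomposition.posPart with hp
  set q := μ.toJordanDecomposition.negPart with hq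
  have hle : μ.totalVariation = p + q := rfl
  have hpK : p.real Kᶜ ≤ δ / 4 := by
    refine ENNReal.toReal_le_of_le_ofReal (by positivity) ?_
    calc p Kᶜ ≤ p (Nᶜ \ K) + p N := by
          refine (measure_mono fun x hx => ?_).trans (measure_union_le _ _)
          by_cases h : x ∈ N
          · exact Or.inr h
          · exact Or.inl ⟨h, hx⟩
      _ ≤ μ.totalVariation (Nᶜ \ K) := by
          rw [hpN, add_zero, hle, Measure.add_apply]
          exact le_self_add
      _ ≤ _ := hKm.le
  have hqK : q.real K'ᶜ ≤ δ / 4 := by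
    refine ENNReal.toReal_le_of_le_ofReal (by positivity) ?_
    calc q K'ᶜ ≤ q (N \ K') + q Nᶜ := by
          refine (measure_mono fun x hx => ?_).trans (measure_union_le _ _)
          by_cases h : x ∈ N
          · exact Or.inl ⟨h, hx⟩
          · exact Or.inr h
      _ ≤ μ.totalVariation (N \ K') := by
          rw [hqN, add_zero, hle, Measure.add_apply]
          exact le_add_self
      _ ≤ _ := hKm'.le
  have hint : ∀ (ν : Measure Ω) [IsFiniteMeasure ν], Integrable (fun x => f x - g x) ν :=
    fun ν _ => Integrable.of_bound (f.continuous.sub g.continuous).measurable.aestronglyMeasurable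
      1 (ae_of_all _ hbound)
  have h₁ := abs_integral_le_mul_measureReal p (g := fun x => 1 - (f x - g x)) (C := 2) (S := Kᶜ)
    (fun x => by have := abs_le.1 (hbound x); exact abs_le.2 ⟨by linarith, by linarith⟩)
    (fun x hx => by
      have hx : x ∈ K := not_not.1 hx
      simp [hfK hx, hgK hx])
  have h₂ := abs_integral_le_mul_measureReal q (g := fun x => 1 + (f x - g x)) (C := 2) (S := K'ᶜ)
    (fun x => by have := abs_le.1 (hbound x); exact abs_le.2 ⟨by linarith, by linarith⟩)
    (fun x hx => by
      have hx : x ∈ K' := not_not.1 hx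
      simp [hfK' hx, hgK' hx])
  rw [integral_sub (integrable_const _) (hint p), integral_const, smul_eq_mul, mul_one] at h₁
  rw [integral_add (integrable_const _) (hint q), integral_const, smul_eq_mul, mul_one] at h₂
  rw [totalVariation_real_apply, sInt, ← hp, ← hq]
  linarith [(abs_le.1 h₁).2, (abs_le.1 h₂).2]

theorem stmt8 {Ω : Type*} [TopologicalSpace Ω] [TopologicalSpace.MetrizableSpace Ω] [LocallyCompactSpace Ω]
    [MeasurableSpace Ω] [BorelSpace Ω]
    (μs : ℕ → SignedMeasure Ω) (μ : SignedMeasure Ω)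
    (hRadonn : ∀ n, ((μs n).totalVariation).InnerRegular)
    (hRadon : (μ.totalVariation).InnerRegular)
    (hvague : VagueTendsto μs μ)
    (hmass : limsup (fun n => (μs n).totalVariation Set.univ) atTop
      ≤ μ.totalVariation Set.univ) :
    ∀ ε : ℝ≥0∞, 0 < ε → ∃ K : Set Ω, IsCompact K ∧
      limsup (fun n => (μs n).totalVariation Kᶜ) atTop ≤ ε := by
  intro ε hε
  obtain ⟨r, hr, hrε⟩ := ENNReal.lt_iff_exists_nnreal_btwn.1 hε
  have hr : 0 < (r : ℝ) := by exact_mod_cast hr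
  obtain ⟨f, hfcont, hfc, hf, hfμ⟩ :=
    exists_hasCompactSupport_totalVariation_sub_le_sInt μ hRadon (δ := r / 3) (by positivity)
  refine ⟨tsupport f, hfc, (limsup_le_of_le (by isBoundedDefault) ?_).trans hrε.le⟩
  have hlim := (hvague f hfcont hfc).eventually
    (lt_mem_nhds (show sInt μ f - r / 3 < sInt μ f by linarith))
  have hsup : ∀ᶠ n in atTop, (μs n).totalVariation Set.univ
      < μ.totalVariation Set.univ + ENNReal.ofReal (r / 3) :=
    eventually_lt_of_limsup_lt (hmass.trans_lt
      (ENNReal.lt_add_right (measure_ne_top _ _) (by simpa using hr)))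
  filter_upwards [hlim, hsup] with n hn hn'
  have hn'' : (μs n).totalVariation.real Set.univ ≤ μ.totalVariation.real Set.univ + r / 3 := by
    have := ENNReal.toReal_mono (by finiteness) hn'.le
    rwa [ENNReal.toReal_add (by finiteness) (by finiteness),
      ENNReal.toReal_ofReal (by positivity)] at this
  have hL := sInt_le_totalVariation_real (μs n) hf fun x hx => image_eq_zero_of_notMem_tsupport hx
  have hcompl := measureReal_add_measureReal_compl (μ := (μs n).totalVariation)
    (s := tsupport f) (isClosed_tsupport f).measurableSet
  rw [← ENNReal.ofReal_coe_nnreal]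
  refine (ENNReal.le_ofReal_iff_toReal_le (by finiteness) r.2).2 ?_
  change (μs n).totalVariation.real (tsupport f)ᶜ ≤ r
  linarith
end

section
/- (Prohorov's theorem for signed measures, part (a)) Let Ω be a metrisable space and let M be a nonempty set of finite signed Radon measures on Ω. If M is uniformly bounded (sup_{μ ∈ M} ‖μ‖ < ∞) and tight (for every ε > 0 there exists a compact set Kε ⊆ Ω with sup_{μ ∈ M} |μ|(Kε^c) ≤ ε), then M is weakly relatively sequentially compact: every sequence in M has a subsequence converging weakly to some finite signed Radon measure on Ω. -/
open MeasureTheory Filter Topology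
open scoped ENNReal

open scoped NNReal

theorem sInt_toSignedMeasure_sub {Ω : Type*} [MeasurableSpace Ω] (μ ν : Measure Ω)
    [IsFiniteMeasure μ] [IsFiniteMeasure ν] {f : Ω → ℝ} (hμ : Integrable f μ)
    (hν : Integrable f ν) :
    sInt (μ.toSignedMeasure - ν.toSignedMeasure) f = ∫ x, f x ∂μ - ∫ x, f x ∂ν := by
  have hsum : μ + (ν - μ) = (μ - ν) + ν := by
    rw [← Measure.toSignedMeasure_eq_toSignedMeasure_iff, Measure.toSignedMeasure_add,
      Measure.toSignedMeasure_add]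
    have h := Measure.sub_toSignedMeasure_eq_toSignedMeasure_sub (μ := μ) (ν := ν)
    rwa [sub_eq_sub_iff_add_eq_add] at h
  have hint := congrArg (fun ρ => ∫ x, f x ∂ρ) hsum
  beta_reduce at hint
  rw [integral_add_measure hμ (hν.mono_measure Measure.sub_le),
    integral_add_measure (hμ.mono_measure Measure.sub_le) hν] at hint
  rw [sInt, Measure.toJordanDecomposition_toSignedMeasure_sub,
    Measure.jordanDecompositionOfToSignedMeasureSub_posPart,
    Measure.jordanDecompositionOfToSignedMeasureSub_negPart]
  linarith

theorem totalVariation_toSignedMeasure_sub_le {Ω : Type*} [MeasurableSpace Ω] (μ ν : Measure Ω)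
    [IsFiniteMeasure μ] [IsFiniteMeasure ν] :
    (μ.toSignedMeasure - ν.toSignedMeasure).totalVariation ≤ μ + ν := by
  rw [SignedMeasure.totalVariation, Measure.toJordanDecomposition_toSignedMeasure_sub,
    Measure.jordanDecompositionOfToSignedMeasureSub_posPart,
    Measure.jordanDecompositionOfToSignedMeasureSub_negPart]
  exact add_le_add Measure.sub_le Measure.sub_le

/-- A tight finite measure on a metrizable space is inner regular. -/
theorem innerRegular_of_forall_exists_isCompact_compl_le {Ω : Type*} [TopologicalSpace Ω]
    [TopologicalSpace.MetrizableSpace Ω] [MeasurableSpace Ω] [BorelSpace Ω] (μ : Measure Ω)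
    [IsFiniteMeasure μ] (h : ∀ ε : ℝ≥0∞, 0 < ε → ∃ K, IsCompact K ∧ μ Kᶜ ≤ ε) :
    μ.InnerRegular := by
  refine ⟨fun s hs r hr => ?_⟩
  obtain ⟨t, hrt, hts⟩ := exists_between hr
  obtain ⟨F, hFs, hF, htF⟩ := hs.exists_lt_isClosed_of_ne_top (measure_ne_top μ s) hts
  obtain ⟨K, hK, hKμ⟩ := h (t - r) (tsub_pos_of_lt hrt)
  refine ⟨K ∩ F, Set.inter_subset_right.trans hFs, hK.inter_right hF, ?_⟩
  by_contra! hle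
  refine htF.not_ge ?_
  calc μ F ≤ μ (K ∩ F ∪ Kᶜ) := measure_mono fun x hx => by
        by_cases hxK : x ∈ K
        · exact Or.inl ⟨hxK, hx⟩
        · exact Or.inr hxK
    _ ≤ μ (K ∩ F) + μ Kᶜ := measure_union_le _ _
    _ ≤ r + (t - r) := add_le_add hle hKμ
    _ = t := add_tsub_cancel_of_le hrt.le

/-- **Prokhorov's theorem**, sequential form, for finite measures on a separable metrizable
space. -/
theorem FiniteMeasure.exists_subseq_tendsto_of_separableSpace {X : Type*} [TopologicalSpace X]
    [TopologicalSpace.MetrizableSpace X] [TopologicalSpace.SeparableSpace X]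
    [MeasurableSpace X] [BorelSpace X] (μ : ℕ → FiniteMeasure X) {C : ℝ≥0} {K : ℕ → Set X}
    {u : ℕ → ℝ≥0} (hu : Tendsto u atTop (𝓝 0)) (hK : ∀ m, IsCompact (K m))
    (hC : ∀ n, (μ n).mass ≤ C) (hμ : ∀ n m, μ n (K m)ᶜ ≤ u m) :
    ∃ (ν : FiniteMeasure X) (φ : ℕ → ℕ), StrictMono φ ∧ Tendsto (μ ∘ φ) atTop (𝓝 ν) := by
  obtain ⟨c, -, φ, hφ, hc⟩ := (isCompact_Icc (a := (0 : ℝ≥0)) (b := C)).tendsto_subseq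
    (x := fun n => (μ n).mass) fun n => ⟨zero_le, hC n⟩
  rcases eq_or_ne c 0 with rfl | hc0
  · exact ⟨0, φ, hφ, FiniteMeasure.tendsto_zero_of_tendsto_zero_mass hc⟩
  have hhalf : c / 2 < c := NNReal.half_lt_self hc0
  have hhalf0 : 0 < c / 2 := by positivity
  obtain ⟨N, hN⟩ := eventually_atTop.1 (hc.eventually_const_lt hhalf)
  have hmass n : c / 2 < (μ (φ (n + N))).mass := hN (n + N) (Nat.le_add_left _ _)
  have hne n : μ (φ (n + N)) ≠ 0 := fun h => by
    have := hmass n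
    simp [h] at this
  have : Nonempty X := by
    by_contra hX
    rw [not_nonempty_iff] at hX
    exact hne 0 (by ext s; simp [Set.eq_empty_of_isEmpty s])
  have hcompact := isCompact_setOfPred_probabilityMeasure_mass_eq_compl_isCompact_le (E := X)
    (u := fun m => (c / 2)⁻¹ * u m) (K := K) (by simpa using hu.const_mul (c / 2)⁻¹) hK
    (Or.inl inferInstance)
  obtain ⟨Q, -, ψ, hψ, hQ⟩ := hcompact.isSeqCompact
    (x := fun n => (μ (φ (n + N))).normalize) fun n m => by
      rw [FiniteMeasure.normalize_eq_of_nonzero _ (hne n)]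
      exact mul_le_mul' (inv_anti₀ hhalf0 (hmass n).le) (hμ _ m)
  have hshift : StrictMono fun n => ψ n + N := hψ.add_const N
  refine ⟨c • Q.toFiniteMeasure, fun n => φ (ψ n + N), hφ.comp hshift, ?_⟩
  have hQ' := (ProbabilityMeasure.toFiniteMeasure_continuous.tendsto Q).comp hQ
  refine ((hc.comp hshift.tendsto_atTop).smul hQ').congr fun n => ?_
  exact (FiniteMeasure.self_eq_mass_smul_normalize _).symm

/-- A finite measure carried by the range of a measurable embedding is the push-forward of its
pull-back. -/
theorem FiniteMeasure.map_comap_of_compl_range {X Ω : Type*} [MeasurableSpace X]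
    [MeasurableSpace Ω] {f : X → Ω} (hf : MeasurableEmbedding f) (μ : FiniteMeasure Ω)
    (h : (μ : Measure Ω) (Set.range f)ᶜ = 0) : (μ.comap f).map f = μ := by
  apply Subtype.ext
  change ((μ : Measure Ω).comap f).map f = μ
  rw [hf.map_comap]
  exact Measure.restrict_eq_self_of_ae_mem (mem_ae_iff.2 h)

/-- **Prokhorov's theorem**, sequential form, for finite measures on a metrizable space. -/
theorem FiniteMeasure.exists_subseq_tendsto {Ω : Type*} [TopologicalSpace Ω]
    [TopologicalSpace.MetrizableSpace Ω] [MeasurableSpace Ω] [BorelSpace Ω]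
    (μ : ℕ → FiniteMeasure Ω) {C : ℝ≥0} {K : ℕ → Set Ω} {u : ℕ → ℝ≥0}
    (hu : Tendsto u atTop (𝓝 0)) (hK : ∀ m, IsCompact (K m))
    (hC : ∀ n, (μ n).mass ≤ C) (hμ : ∀ n m, μ n (K m)ᶜ ≤ u m) :
    ∃ (ν : FiniteMeasure Ω) (φ : ℕ → ℕ), StrictMono φ ∧ Tendsto (μ ∘ φ) atTop (𝓝 ν) ∧
      ∀ m, ν (K m)ᶜ ≤ u m := by
  set S : Set Ω := ⋃ m, K m
  have hS : MeasurableSet S := .iUnion fun m => (hK m).measurableSet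
  have : TopologicalSpace.SeparableSpace S := by
    let := TopologicalSpace.metrizableSpaceMetric Ω
    exact (TopologicalSpace.IsSeparable.iUnion fun m => (hK m).isSeparable).separableSpace
  have hemb : MeasurableEmbedding (Subtype.val : S → Ω) := .subtype_coe hS
  have hrange : Set.range (Subtype.val : S → Ω) = S := Subtype.range_coe
  have hnull n : (μ n : Measure Ω) Sᶜ = 0 := by
    rw [← FiniteMeasure.null_iff_toMeasure_null]
    refine nonpos_iff_eq_zero.1 (ge_of_tendsto' hu fun m => ?_)
    exact ((μ n).apply_mono (Set.compl_subset_compl.2 (Set.subset_iUnion K m))).trans (hμ n m)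
  have himage m : (Subtype.val : S → Ω) '' (Subtype.val ⁻¹' K m)ᶜ ⊆ (K m)ᶜ := by
    rintro _ ⟨x, hx, rfl⟩
    exact hx
  obtain ⟨ν, φ, hφ, hν⟩ := FiniteMeasure.exists_subseq_tendsto_of_separableSpace
    (fun n => (μ n).comap (Subtype.val : S → Ω)) (K := fun m => Subtype.val ⁻¹' K m) hu
    (fun m => Topology.IsInducing.subtypeVal.isCompact_preimage' (hK m)
      (hrange.symm ▸ Set.subset_iUnion K m))
    (fun n => (FiniteMeasure.mass_comap_le _ _).trans (hC n)) fun n m => by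
      refine le_trans ?_ (hμ n m)
      rw [← ENNReal.coe_le_coe, FiniteMeasure.ennreal_coeFn_eq_coeFn_toMeasure,
        FiniteMeasure.ennreal_coeFn_eq_coeFn_toMeasure, FiniteMeasure.toMeasure_comap,
        hemb.comap_apply]
      exact measure_mono (himage m)
  have hlim : Tendsto (μ ∘ φ) atTop (𝓝 (ν.map Subtype.val)) := by
    refine (FiniteMeasure.tendsto_map_of_tendsto_of_continuous _ _ hν
      continuous_subtype_val).congr fun n => ?_
    exact FiniteMeasure.map_comap_of_compl_range hemb _ (hrange.symm ▸ hnull _)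
  refine ⟨_, φ, hφ, hlim, ?_⟩
  exact ((isCompact_setOfPred_finiteMeasure_mass_le_compl_isCompact_le C hu hK
    (Or.inl inferInstance)).isClosed.mem_of_tendsto hlim
    (Eventually.of_forall fun n => ⟨hC _, hμ _⟩)).2

theorem stmt19 {Ω : Type*} [TopologicalSpace Ω] [TopologicalSpace.MetrizableSpace Ω]
    [MeasurableSpace Ω] [BorelSpace Ω]
    (M : Set (SignedMeasure Ω)) (hne : M.Nonempty)
    (hRadon : ∀ μ ∈ M, (SignedMeasure.totalVariation μ).InnerRegular)
    (hbdd : (⨆ μ ∈ M, SignedMeasure.totalVariation μ Set.univ) < ⊤)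
    (htight : ∀ ε : ℝ≥0∞, 0 < ε → ∃ K : Set Ω, IsCompact K ∧
      ∀ μ ∈ M, SignedMeasure.totalVariation μ Kᶜ ≤ ε) :
    ∀ μs : ℕ → SignedMeasure Ω, (∀ n, μs n ∈ M) →
      ∃ (φ : ℕ → ℕ) (ν : SignedMeasure Ω), StrictMono φ ∧
        (SignedMeasure.totalVariation ν).InnerRegular ∧
        WeakTendsto (fun k => μs (φ k)) ν := by
  intro μs hμs
  obtain ⟨u, -, hupos, hu⟩ := exists_seq_strictAnti_tendsto (0 : ℝ≥0)
  choose K hK hKμ using fun m => htight (u m) (by exact_mod_cast hupos m)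
  set C : ℝ≥0 := (⨆ μ ∈ M, SignedMeasure.totalVariation μ Set.univ).toNNReal
  have hC n : (μs n).totalVariation Set.univ ≤ C := by
    rw [ENNReal.coe_toNNReal hbdd.ne]
    exact le_iSup₂ (f := fun μ (_ : μ ∈ M) => SignedMeasure.totalVariation μ Set.univ) _ (hμs n)
  let p n : FiniteMeasure Ω := ⟨(μs n).toJordanDecomposition.posPart, inferInstance⟩
  let q n : FiniteMeasure Ω := ⟨(μs n).toJordanDecomposition.negPart, inferInstance⟩
  have hp n s {a : ℝ≥0} (h : (μs n).totalVariation s ≤ a) : p n s ≤ a := by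
    rw [← ENNReal.coe_le_coe, FiniteMeasure.ennreal_coeFn_eq_coeFn_toMeasure]
    exact (Measure.le_iff'.1 (Measure.le_add_right le_rfl) s).trans h
  have hq n s {a : ℝ≥0} (h : (μs n).totalVariation s ≤ a) : q n s ≤ a := by
    rw [← ENNReal.coe_le_coe, FiniteMeasure.ennreal_coeFn_eq_coeFn_toMeasure]
    exact (Measure.le_iff'.1 (Measure.le_add_left le_rfl) s).trans h
  obtain ⟨ν₁, φ, hφ, hν₁, hνK₁⟩ := FiniteMeasure.exists_subseq_tendsto p hu hK
    (fun n => hp n _ (hC n)) fun n m => hp n _ (hKμ m _ (hμs n))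
  obtain ⟨ν₂, ψ, hψ, hν₂, hνK₂⟩ := FiniteMeasure.exists_subseq_tendsto (q ∘ φ) hu hK
    (fun n => hq _ _ (hC _)) fun n m => hq _ _ (hKμ m _ (hμs _))
  refine ⟨φ ∘ ψ, (ν₁ : Measure Ω).toSignedMeasure - (ν₂ : Measure Ω).toSignedMeasure,
    hφ.comp hψ, innerRegular_of_forall_exists_isCompact_compl_le _ fun ε hε => ?_, ?_⟩
  · have h2u : Tendsto (fun m => (u m : ℝ≥0∞) + u m) atTop (𝓝 0) := by
      simpa using (ENNReal.tendsto_coe.2 hu).add (ENNReal.tendsto_coe.2 hu)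
    obtain ⟨m, hm⟩ := (h2u.eventually_lt_const hε).exists
    refine ⟨K m, hK m, (Measure.le_iff'.1 (totalVariation_toSignedMeasure_sub_le _ _) _).trans
      (le_trans ?_ hm.le)⟩
    rw [Measure.add_apply, ← FiniteMeasure.ennreal_coeFn_eq_coeFn_toMeasure,
      ← FiniteMeasure.ennreal_coeFn_eq_coeFn_toMeasure]
    exact add_le_add (ENNReal.coe_le_coe.2 (hνK₁ m)) (ENNReal.coe_le_coe.2 (hνK₂ m))
  · rintro f hf ⟨B, hB⟩
    let g : BoundedContinuousFunction Ω ℝ := .ofNormedAddCommGroup f hf B hB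
    rw [sInt_toSignedMeasure_sub _ _ (f := f) (g.integrable _) (g.integrable _)]
    exact ((FiniteMeasure.tendsto_iff_forall_integral_tendsto.1 hν₁ g).comp
      hψ.tendsto_atTop).sub (FiniteMeasure.tendsto_iff_forall_integral_tendsto.1 hν₂ g)
end
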